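/- The subgroup 𝓜 of 𝒢 has index 330, i.e. there are exactly 330 cosets of 𝓜 in 𝒢. -/

import Mathlib

/-!
Symmetric generation of `M₂₂` (Hasan–Lim).  `G` is the quotient of the free
group on three generators `x, y, t` by the normal closure of the relators
`x^7, y^2, (xy)^3, [x,y]^4, t^2, [t^{x^2}, y x⁻¹], [t, y],
 (y t^{x^2})^5, (x y x^2 t^x)^5, (x t)^8`,
where `a ^ b := b⁻¹ a b` and `[a, b] := a⁻¹ b⁻¹ a b`.
-/

namespace M22

abbrev F := FreeGroup (Fin 3)
def fx : F := FreeGroup.of 0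
def fy : F := FreeGroup.of 1
def ft : F := FreeGroup.of 2

/-- conjugation `a ^ b = b⁻¹ * a * b` -/
def fconj (a b : F) : F := b⁻¹ * a * b
/-- commutator `[a, b] = a⁻¹ * b⁻¹ * a * b` -/
def fcomm (a b : F) : F := a⁻¹ * b⁻¹ * a * b

def rels : Set F :=
  {fx ^ 7, fy ^ 2, (fx * fy) ^ 3, (fcomm fx fy) ^ 4, ft ^ 2,
   fcomm (fconj ft (fx ^ 2)) (fy * fx⁻¹), fcomm ft fy,
   (fy * fconj ft (fx ^ 2)) ^ 5, (fx * fy * fx ^ 2 * fconj ft fx) ^ 5,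
   (fx * ft) ^ 8}

abbrev G := PresentedGroup rels

def x : G := PresentedGroup.of 0
def y : G := PresentedGroup.of 1
def t : G := PresentedGroup.of 2

/-- The symmetric generators `t₁, …, t₁₄`: for `1 ≤ i ≤ 7`, `tᵢ = t ^ (xⁱ)`,
and for `1 ≤ k ≤ 7`, `t₍₇₊ₖ₎ = t ^ (x⁵ y x^(k-1))`; the index is read modulo
`14` with representatives `1, …, 14`. -/
def tt (i : ℕ) : G :=
  let j := (i - 1) % 14 + 1
  if j ≤ 7 then (x ^ j)⁻¹ * t * x ^ j
  else (x ^ 5 * y * x ^ (j - 8))⁻¹ * t * (x ^ 5 * y * x ^ (j - 8))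

/-- `sᵢ = tᵢ t₍ᵢ₊₇₎`. -/
def s (i : ℕ) : G := tt i * tt (i + 7)

/-- the subgroup `𝓜 = ⟨x, y, s₁⟩` of `G`, where `s₁ = t₁ t₈` -/
def M : Subgroup G := Subgroup.closure {x, y, s 1}

/-! ### Letters and words -/

/-- The letters: `x`, its inverse, the involutions `y`, `t`, and a trivial letter. -/
inductive Ge | x | X | y | t | e

def Ge.inv : Ge → Ge
  | .x => .X | .X => .x | .y => .y | .t => .t | .e => .e

section words
variable {H : Type*} [Group H] (a b c : H)

def lev : Ge → H
  | .x => a | .X => a⁻¹ | .y => b | .t => c | .e => 1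

def wev : List Ge → H
  | [] => 1
  | g :: w => lev a b c g * wev w

theorem lev_inv (hb : b⁻¹ = b) (hc : c⁻¹ = c) (g : Ge) : lev a b c g.inv = (lev a b c g)⁻¹ := by
  cases g <;> simp [lev, Ge.inv, hb, hc]

theorem wev_append (u v : List Ge) : wev a b c (u ++ v) = wev a b c u * wev a b c v := by
  induction u with
  | nil => simp [wev]
  | cons g u ih => simp [wev, ih, mul_assoc]

/-- The inverse word, with accumulator. -/
def invAcc : List Ge → List Ge → List Ge
  | [], acc => acc
  | g :: w, acc => invAcc w (g.inv :: acc)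

theorem wev_invAcc (hb : b⁻¹ = b) (hc : c⁻¹ = c) (w acc : List Ge) :
    wev a b c (invAcc w acc) = (wev a b c w)⁻¹ * wev a b c acc := by
  induction w generalizing acc with
  | nil => simp [wev, invAcc]
  | cons g w ih => simp [wev, invAcc, ih, lev_inv a b c hb hc, mul_assoc]

end words

def relWords : List (List Ge) := [
  [.x, .x, .x, .x, .x, .x, .x],
  [.x, .y, .x, .y, .x, .y],
  [.X, .y, .x, .y, .X, .y, .x, .y, .X, .y, .x, .y, .X, .y, .x, .y],
  [.X, .X, .t, .x, .x, .x, .y, .X, .X, .t, .x, .x, .y, .X],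
  [.t, .y, .t, .y],
  [.y, .X, .X, .t, .x, .x, .y, .X, .X, .t, .x, .x, .y, .X, .X, .t, .x, .x, .y, .X, .X, .t, .x, .x, .y, .X, .X, .t, .x, .x],
  [.x, .y, .x, .t, .x, .x, .y, .x, .t, .x, .x, .y, .x, .t, .x, .x, .y, .x, .t, .x, .x, .y, .x, .t, .x],
  [.x, .t, .x, .t, .x, .t, .x, .t, .x, .t, .x, .t, .x, .t, .x, .t]]

/-- The left hand sides of the eight relations other than `y ^ 2` and `t ^ 2`. -/
def relExprs {H : Type*} [Group H] (a b c : H) : List H :=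
  [a ^ 7, (a * b) ^ 3, (a⁻¹ * b⁻¹ * a * b) ^ 4,
   ((a ^ 2)⁻¹ * c * a ^ 2)⁻¹ * (b * a⁻¹)⁻¹ * ((a ^ 2)⁻¹ * c * a ^ 2) * (b * a⁻¹),
   c⁻¹ * b⁻¹ * c * b,
   (b * ((a ^ 2)⁻¹ * c * a ^ 2)) ^ 5, (a * b * a ^ 2 * (a⁻¹ * c * a)) ^ 5,
   (a * c) ^ 8]

theorem relExprs_eq {H : Type*} [Group H] (a b c : H) (hb : b⁻¹ = b) (hc : c⁻¹ = c) :
    relWords.map (wev a b c) = relExprs a b c := by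
  simp [relWords, relExprs, wev, lev, pow_succ, mul_assoc, hb, hc]

/-! ### The relations in `G` -/

theorem rel_one {r : F} (h : r ∈ rels) : PresentedGroup.mk rels r = 1 :=
  PresentedGroup.one_of_mem h

theorem y_inv : y⁻¹ = y := by
  have h : PresentedGroup.mk rels (fy ^ 2) = 1 := rel_one (by simp [rels])
  have h2 : y ^ 2 = 1 := h
  rw [inv_eq_iff_mul_eq_one, ← pow_two, h2]

theorem t_inv : t⁻¹ = t := by
  have h : PresentedGroup.mk rels (ft ^ 2) = 1 := rel_one (by simp [rels])
  have h2 : t ^ 2 = 1 := h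
  rw [inv_eq_iff_mul_eq_one, ← pow_two, h2]

theorem relWords_one : ∀ w ∈ relWords, wev x y t w = 1 := by
  have h : ∀ g ∈ relExprs x y t, g = 1 := by
    have e : relExprs x y t = (relExprs fx fy ft).map (PresentedGroup.mk rels) := rfl
    rw [e]
    intro g hg
    obtain ⟨r, hr, rfl⟩ := List.mem_map.1 hg
    apply rel_one
    simp only [relExprs, List.mem_cons, List.not_mem_nil, or_false] at hr
    simp only [rels, fcomm, fconj, Set.mem_insert_iff, Set.mem_singleton_iff]
    tauto
  rw [← relExprs_eq x y t y_inv t_inv] at h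
  intro w hw
  exact h _ (List.mem_map_of_mem hw)

theorem x_mem : x ∈ M := Subgroup.subset_closure (by simp)
theorem y_mem : y ∈ M := Subgroup.subset_closure (by simp)

theorem s_one : s 1 = x⁻¹ * t * x * (y * (x ^ 5)⁻¹ * t * x ^ 5 * y) := by
  simp [s, tt, y_inv, mul_assoc]

theorem x_seven : x ^ 7 = 1 := by
  have h : PresentedGroup.mk rels (fx ^ 7) = 1 := rel_one (by simp [rels])
  exact h

theorem x_five : (x ^ 5)⁻¹ = x * x := by
  rw [inv_eq_iff_mul_eq_one, ← x_seven]; group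

theorem sub_mem : t * x * y * x * x * t ∈ M := by
  have h : s 1 ∈ M := Subgroup.subset_closure (by simp)
  have h2 : x * s 1 * (x ^ 5 * y)⁻¹ ∈ M :=
    M.mul_mem (M.mul_mem x_mem h) (M.inv_mem (M.mul_mem (M.pow_mem x_mem _) y_mem))
  have e : x * s 1 * (x ^ 5 * y)⁻¹ = t * x * y * x * x * t := by
    rw [s_one, x_five]; group
  rwa [e] at h2

/-! ### A coset enumeration, in continuation passing style

Labels of cosets are lists of bits; the coset table is a binary trie. -/

abbrev Lab := List Bool

inductive Tr
  | L
  | R (a b c d e : Lab)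
  | N (l r : Tr)

/-- The entry of the table at a label and a letter (by explicit recursors, for fast reduction). -/
noncomputable def get (T : Tr) (k : Lab) (g : Ge) : Lab :=
  List.rec (motive := fun _ => Tr → Lab)
    (fun T => Tr.rec (motive := fun _ => Lab) []
      (fun a b c d e => Ge.rec (motive := fun _ => Lab) a b c d e g) (fun _ _ _ _ => []) T)
    (fun i _ ih T => Tr.rec (motive := fun _ => Lab) [] (fun _ _ _ _ _ => [])
      (fun l r _ _ => Bool.rec (motive := fun _ => Lab) (ih l) (ih r) i) T) k T

noncomputable def setC (g : Ge) (v : Lab) (k : Lab) (T : Tr) (cont : Tr → Bool) : Bool :=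
  List.rec (motive := fun _ => Tr → (Tr → Bool) → Bool)
    (fun T cont => Tr.rec (motive := fun _ => Bool)
      (Ge.rec (motive := fun _ => Bool) (cont (.R v [] [] [] [])) (cont (.R [] v [] [] []))
        (cont (.R [] [] v [] [])) (cont (.R [] [] [] v [])) (cont (.R [] [] [] [] v)) g)
      (fun a b c d e => Ge.rec (motive := fun _ => Bool) (cont (.R v b c d e)) (cont (.R a v c d e))
        (cont (.R a b v d e)) (cont (.R a b c v e)) (cont (.R a b c d v)) g)
      (fun l r _ _ => cont (.N l r)) T)
    (fun i _ ih T cont => Tr.rec (motive := fun _ => Bool)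
      (Bool.rec (motive := fun _ => Bool) (ih .L (fun l => cont (.N l .L)))
        (ih .L (fun r => cont (.N .L r))) i)
      (fun a b c d e => cont (.R a b c d e))
      (fun l r _ _ => Bool.rec (motive := fun _ => Bool) (ih l (fun l' => cont (.N l' r)))
        (ih r (fun r' => cont (.N l r'))) i) T) k T cont

theorem get_L (k : Lab) (g : Ge) : get .L k g = [] := by cases k <;> rfl
theorem get_R_cons (a b c d e : Lab) (i : Bool) (k : Lab) (g : Ge) :
    get (.R a b c d e) (i :: k) g = [] := rfl
theorem get_R_nil (a b c d e : Lab) (g : Ge) : get (.R a b c d e) [] g =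
    match g with
    | .x => a | .X => b | .y => c | .t => d | .e => e := by cases g <;> rfl
theorem get_N_nil (l r : Tr) (g : Ge) : get (.N l r) [] g = [] := rfl
theorem get_N_false (l r : Tr) (k : Lab) (g : Ge) : get (.N l r) (false :: k) g = get l k g := rfl
theorem get_N_true (l r : Tr) (k : Lab) (g : Ge) : get (.N l r) (true :: k) g = get r k g := rfl

noncomputable def eqL (k l : Lab) : Bool :=
  List.rec (motive := fun _ => Lab → Bool)
    (fun l => List.rec (motive := fun _ => Bool) true (fun _ _ _ => false) l)
    (fun i _ ih l => List.rec (motive := fun _ => Bool) false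
      (fun j l _ => Bool.rec (motive := fun _ => Bool)
        (Bool.rec (motive := fun _ => Bool) (ih l) false j)
        (Bool.rec (motive := fun _ => Bool) false (ih l) j) i) l) k l

noncomputable def ltL (k l : Lab) : Bool :=
  List.rec (motive := fun _ => Lab → Bool) (fun _ => false)
    (fun i _ ih l => List.rec (motive := fun _ => Bool) false
      (fun j l _ => Bool.rec (motive := fun _ => Bool)
        (Bool.rec (motive := fun _ => Bool) (ih l) true j)
        (Bool.rec (motive := fun _ => Bool) false (ih l) j) i) l) k l

noncomputable def bitsC (n k : ℕ) (acc : Lab) (cont : Lab → Bool) : Bool :=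
  Nat.rec (motive := fun _ => ℕ → Lab → Bool) (fun _ acc => cont acc)
    (fun _ ih k acc => Bool.rec (motive := fun _ => Bool) (ih (Nat.div k 2) (true :: acc))
      (ih (Nat.div k 2) (false :: acc)) (Nat.beq (Nat.mod k 2) 0)) n k acc

theorem bitsC_succ (n k : ℕ) (acc : Lab) (cont : Lab → Bool) : bitsC (n + 1) k acc cont =
    match Nat.beq (Nat.mod k 2) 0 with
    | true => bitsC n (Nat.div k 2) (false :: acc) cont
    | false => bitsC n (Nat.div k 2) (true :: acc) cont := by
  change Bool.rec (motive := fun _ => Bool) _ _ (Nat.beq (Nat.mod k 2) 0) = _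
  cases Nat.beq (Nat.mod k 2) 0 <;> rfl

noncomputable def findC (T : Tr) (n : ℕ) (k : Lab) (cont : Lab → Bool) : Bool :=
  Nat.rec (motive := fun _ => Lab → Bool) (fun k => cont k)
    (fun _ ih k => List.rec (motive := fun _ => Bool) (cont k) (fun i l _ => ih (i :: l))
      (get T k .e)) n k

theorem findC_succ (T : Tr) (n : ℕ) (k : Lab) (cont : Lab → Bool) : findC T (n + 1) k cont =
    match get T k .e with
    | [] => cont k
    | i :: l => findC T n (i :: l) cont := by
  change List.rec (motive := fun _ => Bool) _ _ (get T k .e) = _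
  cases get T k .e <;> rfl

abbrev Que := List (Lab × Lab)

/-- Queue the coincidence `o = c` if `o` is defined and is not already `c`. -/
noncomputable def pushC (o c : Lab) (q : Que) (cont : Que → Bool) : Bool :=
  match o with
  | [] => cont q
  | i :: l => match eqL (i :: l) c with
    | true => cont q
    | false => cont ((i :: l, c) :: q)

/-- Insert the edge `a · g = c`. -/
noncomputable def insC (T : Tr) (a : Lab) (g : Ge) (c : Lab) (q : Que) (cont : Tr → Que → Bool) : Bool :=
  pushC (get T a g) c q fun q1 => setC g c a T fun T1 =>
    pushC (get T1 c g.inv) a q1 fun q2 => setC g.inv a c T1 fun T2 => cont T2 q2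

/-- Move the edge `b · g = o` of a label `b` that has been identified with `a`. -/
noncomputable def moveC (T : Tr) (a : Lab) (g : Ge) (o : Lab) (q : Que) (cont : Tr → Que → Bool) : Bool :=
  match o with
  | [] => cont T q
  | i :: l => findC T 50 (i :: l) fun c => insC T a g c q cont

noncomputable def killC (T : Tr) (a b : Lab) (q : Que) (cont : Tr → Que → Bool) : Bool :=
  setC .e a b T fun T0 =>
    moveC T0 a .x (get T b .x) q fun T1 q1 =>
    moveC T1 a .X (get T b .X) q1 fun T2 q2 =>
    moveC T2 a .y (get T b .y) q2 fun T3 q3 =>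
    moveC T3 a .t (get T b .t) q3 cont

noncomputable def mergeC : ℕ → Tr → Que → (Tr → Bool) → Bool
  | 0, T, _, cont => cont T
  | n + 1, T, q, cont => match q with
    | [] => cont T
    | (a, b) :: q => findC T 50 a fun a => findC T 50 b fun b =>
      match eqL a b with
      | true => mergeC n T q cont
      | false => match ltL a b with
        | true => killC T a b q fun T' q' => mergeC n T' q' cont
        | false => killC T b a q fun T' q' => mergeC n T' q' cont

noncomputable def edgeC (T : Tr) (a : Lab) (g : Ge) (c : Lab) (cont : Tr → Bool) : Bool :=
  insC T a g c [] fun T' q => mergeC 5000 T' q cont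

/-- Trace a word; `z` is returned if the trace leaves the table. -/
noncomputable def traceC (T : Tr) (z : Bool) (w : List Ge) (f : Lab) (cont : Lab → Bool) : Bool :=
  List.rec (motive := fun _ => Lab → Bool) (fun f => cont f)
    (fun g _ ih f => List.rec (motive := fun _ => Bool) z (fun i l _ => ih (i :: l)) (get T f g))
    w f

theorem traceC_cons (T : Tr) (z : Bool) (g : Ge) (w : List Ge) (f : Lab) (cont : Lab → Bool) :
    traceC T z (g :: w) f cont = match get T f g with
    | [] => z
    | i :: l => traceC T z w (i :: l) cont := by
  change List.rec (motive := fun _ => Bool) _ _ (get T f g) = _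
  cases get T f g <;> rfl

/-- Scan the relator `u ++ g :: v` (given as `w` with `i` the length of `u`). -/
noncomputable def scanC (T : Tr) (f : Lab) (w : List Ge) (i : ℕ) (cont : Tr → Bool) : Bool :=
  match w.drop i with
  | [] => false
  | g :: v => findC T 50 f fun f =>
      traceC T false (invAcc (v ++ w.take i) []) f fun b => edgeC T f g b cont

noncomputable def runC : List ℕ → Tr → (Tr → Bool) → Bool
  | [], T, cont => cont T
  | n :: ns, T, cont => bitsC 11 (Nat.div n 256) [] fun f =>
      scanC T f (relWords.getD (Nat.mod (Nat.div n 32) 8) []) (Nat.mod n 32) fun T' =>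
        runC ns T' cont

def gen4 : ℕ → Ge
  | 0 => .x | 1 => .X | 2 => .y | _ => .t

noncomputable def initC : List ℕ → ℕ → Tr → (Tr → Bool) → Bool
  | [], _, T, cont => cont T
  | d :: ds, k, T, cont => match Nat.ble (Nat.succ (Nat.div d 4)) k, Nat.ble k 2047 with
    | true, true => bitsC 11 (Nat.div d 4) [] fun a => bitsC 11 k [] fun b =>
        setC (gen4 (Nat.mod d 4)) b a T fun T1 =>
        setC (gen4 (Nat.mod d 4)).inv a b T1 fun T2 => initC ds (Nat.succ k) T2 cont
    | _, _ => false

noncomputable def isLive (T : Tr) (k : Lab) : Bool :=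
  match get T k .x, get T k .e with
  | _ :: _, [] => true
  | _, _ => false

def cnt : Tr → ℕ
  | .L => 0
  | .R a _ _ _ e => match a, e with
    | _ :: _, [] => 1
    | _, _ => 0
  | .N l r => Nat.add (cnt l) (cnt r)

/-- All entries in live rows are live. -/
noncomputable def closedT (T₀ : Tr) : Tr → Bool
  | .L => true
  | .R a b c d e => match a, e with
    | _ :: _, [] => isLive T₀ a && (isLive T₀ b && (isLive T₀ c && isLive T₀ d))
    | _, _ => true
  | .N l r => closedT T₀ l && closedT T₀ r

noncomputable def finalCheck (k : Lab) (T : Tr) : Bool :=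
  match T with
  | .N l r => isLive (.N l r) k && (Nat.ble (cnt (.N l r)) 330 && closedT (.N l r) (.N l r))
  | _ => false

/-- Parents of the coset labels: entry `4 * a + g` at place `k` says that label `k` is `a · g`. -/
def defsList : List ℕ := [
  0, 3, 4, 10, 12, 16, 8, 24, 28, 15, 36, 40, 44, 50, 53, 57, 19, 64, 68, 72, 78, 81, 85, 52, 94,
  97, 101, 96, 27, 80, 118, 121, 120, 48, 132, 136, 42, 144, 150, 142, 156, 162, 165, 170, 172,
  178, 181, 186, 188, 194, 139, 200, 204, 208, 214, 217, 221, 227, 228, 108, 86, 241, 246, 248,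
  254, 257, 262, 264, 270, 143, 276, 280, 284, 290, 293, 297, 43, 306, 153, 314, 316, 322, 325,
  330, 332, 338, 47, 346, 134, 352, 230, 360, 366, 369, 374, 376, 382, 304, 388, 392, 398, 401,
  405, 411, 412, 51, 422, 340, 428, 126, 437, 442, 444, 450, 453, 458, 460, 435, 468, 472, 476,
  59, 486, 434, 492, 498, 501, 506, 508, 514, 517, 522, 524, 530, 431, 536, 540, 544, 550, 553,
  557, 252, 70, 568, 572, 578, 581, 586, 588, 255, 596, 600, 604, 610, 613, 617, 623, 624, 128,
  632, 638, 641, 567, 648, 652, 656, 662, 665, 669, 562, 87, 308, 684, 688, 694, 697, 484, 704,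
  708, 714, 717, 95, 726, 495, 732, 736, 740, 275, 748, 752, 756, 762, 765, 292, 774, 777, 680,
  784, 788, 794, 797, 226, 383, 808, 812, 816, 664, 826, 829, 135, 838, 696, 846, 849, 848, 216,
  862, 865, 869, 864, 212, 880, 884, 206, 892, 898, 890, 904, 910, 913, 918, 920, 926, 929, 934,
  936, 942, 887, 948, 952, 956, 962, 965, 969, 975, 976, 876, 786, 989, 994, 996, 1002, 1005,
  1010, 1012, 1018, 891, 1024, 1028, 1032, 1038, 1041, 1045, 207, 1054, 901, 1062, 1064, 1070,
  1073, 1078, 1080, 1086, 211, 1094, 882, 1100, 978, 1108, 1114, 1117, 1122, 1124, 1130, 1052,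
  1136, 1140, 1146, 1149, 1153, 1159, 1160, 215, 1170, 1088, 1176, 834, 1185, 1190, 1192, 1198,
  1201, 1206, 1208, 1183, 1216, 1220, 1224, 223, 1234, 1182, 1240, 1246, 1249, 1254, 1256, 1262,
  1265, 1270, 1272, 1278, 1179, 1284, 1288, 1292, 1298, 1301, 1305, 776, 874, 796, 400, 552,
  1330, 1333, 1337, 288, 1344, 1348, 282, 1356, 1360, 1366, 1369, 1374, 1376, 1351, 1384, 1388,
  1392, 1398, 1401, 1405, 1411, 1412, 1312, 1420, 1426, 1429, 1355, 1436, 1440, 1444, 1450, 1453,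
  1457, 1350, 1464, 1470, 1473, 1478, 1480, 1486, 287, 1494, 1346, 1500, 1414, 1508, 1514, 1517,
  1522, 1524, 1530, 1501, 1537, 291, 1546, 1488, 1552, 542, 1561, 1566, 1568, 1574, 299, 1582,
  1558, 1588, 1594, 1597, 1602, 1604, 1610, 1613, 1618, 1620, 1626, 1555, 1632, 1636, 1640, 1646,
  1649, 1653, 396, 1660, 1664, 390, 1672, 1678, 1670, 1684, 1690, 1693, 1698, 1700, 1706, 1709,
  1714, 1716, 1722, 1667, 1728, 1732, 1736, 1742, 1745, 1749, 1755, 1756, 692, 1764, 686, 1771,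
  1776, 1780, 1784, 1790, 1793, 1797, 1803, 1804, 716, 612, 1818, 1821, 1332, 1820, 480, 1810,
  1840, 1846, 1849, 1854, 1856, 1862, 391, 1870, 1770, 1876, 1882, 1885, 1890, 1892, 1898, 395,
  1906, 1662, 1912, 1758, 1920, 1926, 1929, 1934, 1936, 1942, 1868, 1948, 1952, 1958, 1961, 1965,
  1971, 1972, 399, 1982, 1900, 1988, 618, 1997, 2002, 2004, 2010, 2013, 2018, 2020, 1995, 407,
  2034, 1994, 2040, 2046, 2049, 2054, 2056, 2062, 2065, 2070, 2072, 2078, 1991, 2084, 2088, 2092,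
  2098, 2101, 2105, 844, 2112, 2116, 702, 2124, 2130, 2122, 2136, 2142, 2145, 2150, 2152, 2158,
  2161, 2166, 2168, 2174, 2119, 2180, 2184, 2188, 2194, 2197, 2201, 2207, 2208, 1812, 2216, 722,
  2223, 2228, 2232, 2236, 2242, 2245, 2249, 2255, 2256, 764, 2266, 2269, 1864, 474, 2280, 2286,
  2278, 2292, 2298, 2301, 2306, 2308, 2314, 2317, 2322, 2324, 2330, 1867, 2336, 2340, 2344, 2350,
  2353, 2357, 2363, 2364, 738, 2373, 2378, 2380, 2386, 2389, 2394, 2396, 2279, 2404, 2408, 2412,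
  2418, 2421, 654, 2289, 2434, 2436, 2442, 2445, 479, 2454, 660, 2462, 2465, 2469, 2475, 712,
  2480, 706, 2487, 2492, 2496, 2500, 2506, 2509, 2513, 2519, 2520, 602, 2011, 2532, 2536, 2540,
  2546, 2549, 2553, 2559, 2560, 2268, 548, 1527, 2576, 2580, 2584, 2590, 2593, 2597, 2603, 1531,
  2608, 2612, 2616, 2622, 2625, 2629, 543, 2638, 1554, 2644, 2650, 2653, 2658, 2660, 2666, 2574,
  2672, 2606, 2680, 2686, 2689, 2694, 2696, 2702, 2636, 2708, 2712, 2718, 2721, 2725, 2731, 2732,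
  551, 2742, 2668, 2748, 1375, 2756, 2760, 2764, 559, 2751, 2776, 2780, 2784, 2790, 2793, 1096,
  2526, 2804, 2810, 2813, 2818, 2820, 2826, 1703, 2832, 2836, 2840, 2846, 2849, 2853, 603, 2862,
  2486, 2868, 2874, 2877, 2882, 2884, 2890, 2860, 2896, 2900, 2906, 2909, 1754, 1943, 2920, 2924,
  2928, 619, 1939, 2940, 2944, 2948, 2954, 2957, 828, 1236, 2968, 2972, 2978, 2981, 2985, 2991,
  2992, 2964, 1125, 3006, 3008, 3014, 3017, 3022, 3024, 3030, 1135, 3036, 3040, 3044, 3050, 3053,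
  3057, 1158, 1310, 671, 1199, 3076, 3080, 3084, 3090, 3093, 1056, 3100, 3104, 3110, 3113, 3117,
  1683, 3124, 3128, 3132, 3138, 3141, 3145, 687, 3152, 3156, 3160, 3166, 3169, 3173, 2518, 2071,
  703, 3190, 707, 711, 3196, 3204, 3208, 3214, 3217, 3221, 2558, 2059, 3232, 3236, 3240, 723,
  3250, 2264, 3256, 3263, 3264, 3268, 3272, 3278, 3281, 3285, 3192, 3292, 3296, 3302, 3305, 2055,
  3312, 3316, 3320, 3326, 3329, 991, 3336, 3340, 3344, 3350, 3353, 3357, 907, 3364, 3368, 3372,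
  3378, 3381, 3385, 755, 3392, 3396, 3400, 3406, 3409, 3413, 3122, 1259, 3424, 3428, 3432, 771,
  3442, 1580, 3448, 3452, 3458, 3461, 3465, 2602, 1363, 3476, 3480, 3484, 1462, 787, 791, 3046,
  3505, 3509, 974, 1271, 3520, 3524, 3528, 803, 3538, 3444, 3544, 3548, 3554, 3557, 1275, 3564,
  3568, 3572, 3578, 3581, 3072, 3588, 3592, 3598, 3601, 3605, 3362, 1131, 3616, 3620, 3624, 3062,
  2036, 3636, 3640, 3646, 3649, 3653, 3252, 3660, 3664, 3670, 3673, 3677, 3188, 3684, 3688, 3694,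
  3697, 1947, 3704, 3708, 3712, 3140, 3722, 3725, 1232, 3732, 3736, 3742, 3745, 863, 1255, 3756,
  3760, 3764, 3540, 3772, 3776, 3782, 3785, 1040, 3794, 3797, 883, 3806, 3092, 3814, 3817, 3821,
  3804, 3828, 3832, 964, 3842, 3845, 3849, 3844, 3816, 1195, 3864, 3868, 3872, 960, 3880, 3884,
  954, 3892, 3898, 3890, 3904, 3910, 3913, 3918, 3920, 3926, 3929, 3934, 3936, 3942, 3887, 3948,
  3952, 3956, 3962, 3965, 3969, 3975, 3976, 3856, 3590, 3989, 3994, 3996, 4002, 4005, 4010, 4012,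
  4018, 3891, 4024, 4028, 4032, 4038, 4041, 4045, 955, 4054, 3901, 4062, 4064, 4070, 4073, 4078,
  4080, 4086, 959, 4094, 3882, 4100, 3978, 4108, 4114, 4117, 4122, 4124, 4130, 4052, 4136, 4140,
  4146, 4149, 4153, 4159, 4160, 963, 4170, 4088, 4176, 3753, 4186, 4188, 4194, 4197, 4202, 4204,
  4183, 4212, 4216, 4220, 971, 4230, 3778, 4236, 4242, 4245, 4250, 4252, 4258, 4179, 4264, 4268,
  4272, 4278, 4281, 4285, 3796, 3854, 3504, 3440, 2502, 2861]

/-- The deductions: `256 * f + 32 * r + i` scans relator `r` with gap at letter `i` at label `f`. -/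
def stepsList : List ℕ := [
  1894, 385, 1057, 2048, 3945, 2081, 5737, 5761, 4515, 4225, 6761, 7014, 7297, 8040, 8294, 8960,
  9760, 12608, 14955, 9826, 9600, 15137, 17472, 19305, 19840, 18083, 4896, 15392, 21824, 22400,
  12320, 22817, 24640, 26731, 27264, 24352, 17184, 27648, 29763, 30822, 31360, 7456, 28416, 2914,
  34112, 35945, 33824, 36096, 36641, 40299, 36897, 23040, 17440, 37632, 40481, 41281, 43113,
  30371, 40448, 23808, 39809, 23906, 24192, 21858, 31682, 27425, 19329, 17793, 43392, 43649,
  44904, 46184, 46720, 47718, 47267, 30081, 49256, 43137, 50024, 51304, 51584, 52582, 52131,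
  51841, 53352, 53888, 54632, 54886, 55913, 56166, 56832, 57632, 60480, 62827, 57698, 63009,
  65344, 67177, 67712, 63264, 52512, 69696, 70272, 70689, 72512, 74603, 75136, 72224, 65056,
  75520, 77635, 78694, 79232, 52768, 58145, 76576, 58880, 81984, 83817, 75808, 81696, 84070,
  84352, 84582, 84838, 85865, 86528, 87073, 90731, 86912, 90913, 93545, 78243, 95296, 87584,
  96289, 98112, 97824, 91424, 99584, 100928, 100640, 104256, 99872, 103968, 106752, 107552,
  110400, 112747, 106850, 58752, 113152, 115819, 116070, 116840, 117094, 117024, 88064, 117097,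
  34944, 117350, 117537, 119360, 119936, 54816, 121664, 122240, 110112, 122657, 124480, 126571,
  127104, 125088, 124192, 127488, 129603, 129891, 130432, 38944, 108065, 128544, 108800, 39009,
  109666, 109952, 44130, 133184, 135017, 132896, 135680, 136480, 139328, 141675, 112929, 120353,
  142080, 142368, 144747, 145512, 145664, 151659, 121633, 153667, 155240, 155520, 116000, 153632,
  130849, 139297, 123392, 153705, 127360, 157312, 158570, 158976, 161643, 158753, 161824, 164203,
  164454, 164608, 166762, 103785, 91497, 91264, 170816, 171297, 173120, 172832, 90880, 176128,
  170850, 176064, 177254, 176803, 182889, 183424, 185152, 185088, 185193, 124610, 129921, 135489,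
  135201, 164384, 72448, 142624, 64032, 65312, 48640, 72064, 48489, 55617, 80128, 67201, 69571,
  164450, 186472, 186752, 187750, 188033, 189544, 189798, 191851, 50944, 192033, 195945, 187299,
  192000, 196224, 196737, 198248, 199785, 201577, 201857, 200355, 203369, 203648, 202400, 203393,
  203875, 204416, 204673, 206441, 206720, 207718, 208256, 207267, 208640, 210537, 135363, 208451,
  145473, 211816, 213352, 212097, 215145, 216937, 217217, 218729, 219008, 218753, 220006, 220544,
  219555, 223873, 223968, 224873, 225152, 225123, 226150, 226688, 227944, 229480, 228770, 225409,
  231017, 231296, 232294, 232576, 231843, 231553, 234089, 235625, 235649, 236904, 237926, 237475,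
  187009, 239976, 240257, 241254, 240803, 242536, 243304, 190115, 244841, 246633, 246886, 247142,
  248166, 248832, 249632, 252480, 254827, 249698, 255009, 257344, 259177, 259712, 255264, 232224,
  261696, 262689, 264512, 266603, 264224, 257056, 267520, 242465, 269379, 250145, 268320, 272704,
  272416, 275072, 275302, 275200, 263457, 229888, 241664, 225569, 215106, 271393, 145024, 256000,
  210113, 246305, 195393, 261571, 268483, 214560, 255329, 268739, 259808, 130272, 204768, 244960,
  124867, 79072, 210883, 212448, 160225, 218848, 163267, 61347, 198307, 75232, 197570, 186081,
  214497, 114336, 113888, 115169, 114882, 207553, 186080, 235489, 190368, 207297, 212929, 111584,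
  275558, 275681, 275778, 268740, 275907, 276072, 276163, 276128]

noncomputable def check : Bool :=
  initC (defsList.drop 1) 1 .L fun T => bitsC 11 0 [] fun o =>
  edgeC T o .x o fun T => edgeC T o .y o fun T =>
  traceC T false [.t, .x, .y, .x, .x] o fun a => edgeC T a .t o fun T =>
  runC stepsList T fun T => finalCheck o T

theorem check_true : check = true := by decide +kernel

/-! ### Soundness of the enumeration -/

theorem eqL_eq : ∀ {k l : Lab}, eqL k l = true → k = l
  | [], [], _ => rfl
  | [], _ :: _, h => by cases h
  | _ :: _, [], h => by cases h
  | false :: k, false :: l, h => by rw [eqL_eq (k := k) (l := l) h]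
  | true :: k, true :: l, h => by rw [eqL_eq (k := k) (l := l) h]
  | false :: _, true :: _, h => by cases h
  | true :: _, false :: _, h => by cases h

theorem isLive_N_false (l r : Tr) (k : Lab) : isLive (.N l r) (false :: k) = isLive l k := rfl
theorem isLive_N_true (l r : Tr) (k : Lab) : isLive (.N l r) (true :: k) = isLive r k := rfl

theorem setC_spec (g : Ge) (v : Lab) : ∀ (k : Lab) (T : Tr), ∃ T' : Tr,
    (∀ cont, setC g v k T cont = cont T') ∧
    ∀ k' g', get T' k' g' = [] ∨ get T' k' g' = get T k' g' ∨
      (k' = k ∧ g' = g ∧ get T' k' g' = v) := by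
  intro k
  induction k with
  | nil =>
    intro T
    cases T with
    | L =>
      cases g <;> refine ⟨_, fun cont => rfl, ?_⟩ <;> intro k' g' <;> cases k' <;> cases g' <;>
        simp [get_L, get_R_nil, get_R_cons, get_N_nil, get_N_false, get_N_true]
    | R a b c d e =>
      cases g <;> refine ⟨_, fun cont => rfl, ?_⟩ <;> intro k' g' <;> cases k' <;> cases g' <;>
        simp [get_L, get_R_nil, get_R_cons, get_N_nil, get_N_false, get_N_true]
    | N l r => exact ⟨.N l r, fun cont => rfl, fun k' g' => Or.inr (Or.inl rfl)⟩
  | cons i k ih =>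
    intro T
    cases T with
    | L =>
      obtain ⟨T', h1, h2⟩ := ih .L
      cases i
      · refine ⟨.N T' .L, fun cont => h1 _, ?_⟩
        intro k' g'
        rcases k' with _ | ⟨j, k'⟩
        · left; rfl
        · cases j
          · simpa [get_N_false, get_N_true, get_L] using h2 _ _
          · left; simp [get_L, get_R_nil, get_R_cons, get_N_nil, get_N_false, get_N_true]
      · refine ⟨.N .L T', fun cont => h1 _, ?_⟩
        intro k' g'
        rcases k' with _ | ⟨j, k'⟩
        · left; rfl
        · cases j
          · left; simp [get_L, get_R_nil, get_R_cons, get_N_nil, get_N_false, get_N_true]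
          · simpa [get_N_false, get_N_true, get_L] using h2 _ _
    | R a b c d e =>
      exact ⟨.R a b c d e, fun cont => rfl, fun k' g' => Or.inr (Or.inl rfl)⟩
    | N l r =>
      cases i
      · obtain ⟨T', h1, h2⟩ := ih l
        refine ⟨.N T' r, fun cont => h1 _, ?_⟩
        intro k' g'
        rcases k' with _ | ⟨j, k'⟩
        · left; rfl
        · cases j
          · simpa [get_N_false, get_N_true] using h2 _ _
          · right; left; simp [get_L, get_R_nil, get_R_cons, get_N_nil, get_N_false, get_N_true]
      · obtain ⟨T', h1, h2⟩ := ih r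
        refine ⟨.N l T', fun cont => h1 _, ?_⟩
        intro k' g'
        rcases k' with _ | ⟨j, k'⟩
        · left; rfl
        · cases j
          · right; left; simp [get_L, get_R_nil, get_R_cons, get_N_nil, get_N_false, get_N_true]
          · simpa [get_N_false, get_N_true] using h2 _ _

/-- The right action of a word on the cosets. -/
def act (w : List Ge) (p : G ⧸ M) : G ⧸ M := (wev x y t w)⁻¹ • p

theorem act_nil (p : G ⧸ M) : act [] p = p := by simp [act, wev]

theorem act_append (u v : List Ge) (p : G ⧸ M) : act (u ++ v) p = act v (act u p) := by
  simp [act, wev_append, mul_smul]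

theorem act_cons (g : Ge) (v : List Ge) (p : G ⧸ M) : act (g :: v) p = act v (act [g] p) :=
  act_append [g] v p

theorem act_inv {g : Ge} {p q : G ⧸ M} (h : act [g] p = q) : act [g.inv] q = p := by
  subst h
  simp [act, wev, lev_inv x y t y_inv t_inv]

theorem act_e (p : G ⧸ M) : act [.e] p = p := by simp [act, wev, lev]

/-- All entries of the table are true. -/
def Valid (φ : Lab → G ⧸ M) (T : Tr) : Prop :=
  ∀ k g, get T k g ≠ [] → act [g] (φ k) = φ (get T k g)

def ValidQ (φ : Lab → G ⧸ M) (q : Que) : Prop := ∀ a b, (a, b) ∈ q → φ a = φ b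

section sound
variable {φ : Lab → G ⧸ M} {P : Prop}

theorem setC_sound {T : Tr} {k : Lab} {g : Ge} {v : Lab} {cont : Tr → Bool} (hT : Valid φ T)
    (hv : act [g] (φ k) = φ v) (hc : ∀ T', Valid φ T' → cont T' = true → P)
    (h : setC g v k T cont = true) : P := by
  obtain ⟨T', h1, h2⟩ := setC_spec g v k T
  rw [h1] at h
  refine hc T' ?_ h
  intro k' g' hne
  rcases h2 k' g' with h3 | h3 | ⟨rfl, rfl, h3⟩
  · exact absurd h3 hne
  · rw [h3] at hne ⊢
    exact hT k' g' hne
  · rw [h3, hv]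

theorem findC_sound {T : Tr} (hT : Valid φ T) {cont : Lab → Bool} (n : ℕ) :
    ∀ k : Lab, (∀ k', φ k' = φ k → cont k' = true → P) → findC T n k cont = true → P := by
  induction n with
  | zero => intro k hc h; exact hc k rfl h
  | succ n ih =>
    intro k hc h
    rw [findC_succ] at h
    split at h
    · exact hc k rfl h
    · rename_i i l he
      refine ih (i :: l) ?_ h
      have := hT k .e (by simp [he])
      rw [act_e, he] at this
      rw [← this]
      exact hc

theorem pushC_sound {o c : Lab} {q : Que} {cont : Que → Bool} (hq : ValidQ φ q)
    (ho : o ≠ [] → φ o = φ c) (hc : ∀ q', ValidQ φ q' → cont q' = true → P)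
    (h : pushC o c q cont = true) : P := by
  unfold pushC at h
  split at h
  · exact hc q hq h
  · split at h
    · exact hc q hq h
    · refine hc _ ?_ h
      intro a b hab
      rcases List.mem_cons.1 hab with h1 | h1
      · cases h1; exact ho (by simp)
      · exact hq a b h1

theorem insC_sound {T : Tr} {a : Lab} {g : Ge} {c : Lab} {q : Que} {cont : Tr → Que → Bool}
    (hT : Valid φ T) (hq : ValidQ φ q) (he : act [g] (φ a) = φ c)
    (hc : ∀ T' q', Valid φ T' → ValidQ φ q' → cont T' q' = true → P)
    (h : insC T a g c q cont = true) : P := by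
  unfold insC at h
  refine pushC_sound hq (fun h0 => ?_) (fun q1 hq1 h => ?_) h
  · rw [← hT a g h0, he]
  refine setC_sound hT he (fun T1 hT1 h => ?_) h
  refine pushC_sound hq1 (fun h0 => ?_) (fun q2 hq2 h => ?_) h
  · rw [← hT1 c g.inv h0, act_inv he]
  exact setC_sound hT1 (act_inv he) (fun T2 hT2 h => hc T2 q2 hT2 hq2 h) h

theorem moveC_sound {T : Tr} {a : Lab} {g : Ge} {o : Lab} {q : Que} {cont : Tr → Que → Bool}
    (hT : Valid φ T) (hq : ValidQ φ q) (he : o ≠ [] → act [g] (φ a) = φ o)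
    (hc : ∀ T' q', Valid φ T' → ValidQ φ q' → cont T' q' = true → P)
    (h : moveC T a g o q cont = true) : P := by
  unfold moveC at h
  split at h
  · exact hc T q hT hq h
  · refine findC_sound hT 50 _ (fun c hcc h => ?_) h
    exact insC_sound hT hq (by rw [he (by simp), hcc]) hc h

theorem killC_sound {T : Tr} {a b : Lab} {q : Que} {cont : Tr → Que → Bool}
    (hT : Valid φ T) (hq : ValidQ φ q) (he : φ a = φ b)
    (hc : ∀ T' q', Valid φ T' → ValidQ φ q' → cont T' q' = true → P)
    (h : killC T a b q cont = true) : P := by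
  unfold killC at h
  refine setC_sound hT (by rw [act_e, he]) (fun T0 hT0 h => ?_) h
  refine moveC_sound hT0 hq (fun h0 => by rw [he]; exact hT b _ h0) (fun T1 q1 hT1 hq1 h => ?_) h
  refine moveC_sound hT1 hq1 (fun h0 => by rw [he]; exact hT b _ h0) (fun T2 q2 hT2 hq2 h => ?_) h
  refine moveC_sound hT2 hq2 (fun h0 => by rw [he]; exact hT b _ h0) (fun T3 q3 hT3 hq3 h => ?_) h
  exact moveC_sound hT3 hq3 (fun h0 => by rw [he]; exact hT b _ h0) hc h

theorem mergeC_sound {cont : Tr → Bool} (hc : ∀ T', Valid φ T' → cont T' = true → P) (n : ℕ) :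
    ∀ (T : Tr) (q : Que), Valid φ T → ValidQ φ q → mergeC n T q cont = true → P := by
  induction n with
  | zero => intro T q hT _ h; exact hc T hT h
  | succ n ih =>
    intro T q hT hq h
    rw [mergeC.eq_def] at h
    dsimp only at h
    split at h
    · exact hc T hT h
    · rename_i a b q
      have hab : φ a = φ b := hq a b (by simp)
      have hq' : ValidQ φ q := fun u v huv => hq u v (List.mem_cons_of_mem _ huv)
      refine findC_sound hT 50 _ (fun a' ha h => ?_) h
      refine findC_sound hT 50 _ (fun b' hb h => ?_) h
      have hab' : φ a' = φ b' := by rw [ha, hb, hab]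
      split at h
      · exact ih T q hT hq' h
      · split at h
        · exact killC_sound hT hq' hab' (fun T' q' hT' hq' h => ih T' q' hT' hq' h) h
        · exact killC_sound hT hq' hab'.symm (fun T' q' hT' hq' h => ih T' q' hT' hq' h) h

theorem edgeC_sound {T : Tr} {a : Lab} {g : Ge} {c : Lab} {cont : Tr → Bool}
    (hT : Valid φ T) (he : act [g] (φ a) = φ c)
    (hc : ∀ T', Valid φ T' → cont T' = true → P)
    (h : edgeC T a g c cont = true) : P :=
  insC_sound hT (fun a b hab => by simp at hab) he
    (fun T' q hT' hq h => mergeC_sound hc _ T' q hT' hq h) h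

theorem traceC_sound {T : Tr} (hT : Valid φ T) {cont : Lab → Bool} :
    ∀ (w : List Ge) (f : Lab), (∀ b, act w (φ f) = φ b → cont b = true → P) →
      traceC T false w f cont = true → P
  | [], f, hc, h => hc f (act_nil _) h
  | g :: w, f, hc, h => by
    rw [traceC_cons] at h
    split at h
    · cases h
    · rename_i i l he
      refine traceC_sound hT w (i :: l) (fun b hb h => hc b ?_ h) h
      rw [act_cons, hT f g (by simp [he]), he, hb]

theorem scanC_sound {T : Tr} {f : Lab} {w : List Ge} {i : ℕ} {cont : Tr → Bool}
    (hT : Valid φ T) (hw : wev x y t w = 1)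
    (hc : ∀ T', Valid φ T' → cont T' = true → P)
    (h : scanC T f w i cont = true) : P := by
  unfold scanC at h
  split at h
  · cases h
  · rename_i g v hd
    refine findC_sound hT 50 _ (fun f' _ h => ?_) h
    refine traceC_sound hT _ _ (fun b hb h => ?_) h
    refine edgeC_sound hT ?_ hc h
    rw [← hb]
    have e : w.take i ++ g :: v = w := by rw [← hd, List.take_append_drop]
    rw [← e, wev_append, wev] at hw
    have e2 : lev x y t g = (wev x y t (w.take i))⁻¹ * (wev x y t v)⁻¹ := by
      rw [← mul_inv_rev]
      rw [← mul_assoc] at hw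
      have h3 := mul_eq_one_iff_eq_inv.1 hw
      rw [mul_inv_rev, ← h3]; group
    simp [act, wev_invAcc x y t y_inv t_inv, wev, wev_append, e2]

theorem bitsC_sound {cont : Lab → Bool} (hc : ∀ l, cont l = true → P)
    (n : ℕ) : ∀ (k : ℕ) (acc : Lab), bitsC n k acc cont = true → P := by
  induction n with
  | zero => intro k acc h; exact hc _ h
  | succ n ih =>
    intro k acc h
    rw [bitsC_succ] at h
    split at h <;> exact ih _ _ h

theorem runC_sound {cont : Tr → Bool} (hc : ∀ T', Valid φ T' → cont T' = true → P) :
    ∀ (ns : List ℕ) (T : Tr), Valid φ T → runC ns T cont = true → P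
  | [], T, hT, h => hc T hT h
  | n :: ns, T, hT, h => by
    rw [runC] at h
    refine bitsC_sound (fun f h => ?_) 11 _ _ h
    refine scanC_sound hT ?_ (fun T' hT' h => runC_sound hc ns T' hT' h) h
    by_cases hi : Nat.mod (Nat.div n 32) 8 < relWords.length
    · rw [List.getD_eq_getElem _ _ hi]
      exact relWords_one _ (List.getElem_mem hi)
    · rw [List.getD_eq_default _ _ (by omega)]
      rfl

end sound

/-! ### The interpretation of the labels -/

def base : G ⧸ M := ((1 : G) : G ⧸ M)

noncomputable def phiN (k : ℕ) : G ⧸ M :=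
  if _h : defsList.getD k 0 / 4 < k then
    act [gen4 (defsList.getD k 0 % 4)] (phiN (defsList.getD k 0 / 4))
  else base
termination_by k

def val : Lab → ℕ
  | [] => 0
  | i :: l => (cond i 1 0) * 2 ^ l.length + val l

noncomputable def phi (l : Lab) : G ⧸ M := phiN (val l)

theorem bitsC_val {P : Prop} {cont : Lab → Bool} (n : ℕ) :
    ∀ (k : ℕ) (acc : Lab), k < 2 ^ n →
      (∀ l, val l = k * 2 ^ acc.length + val acc → cont l = true → P) →
      bitsC n k acc cont = true → P := by
  induction n with
  | zero =>
    intro k acc hk hc h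
    refine hc acc ?_ h
    have : k = 0 := by simpa using hk
    simp [this]
  | succ n ih =>
    intro k acc hk hc h
    have hk2 : k / 2 < 2 ^ n := by rw [pow_succ] at hk; omega
    have hm := Nat.div_add_mod k 2
    rw [bitsC_succ] at h
    split at h
    · rename_i h0
      have h0' : k % 2 = 0 := Nat.eq_of_beq_eq_true h0
      refine ih _ _ hk2 (fun l hl h => hc l ?_ h) h
      rw [hl]
      have : k = 2 * (k / 2) := by omega
      conv_rhs => rw [this]
      simp [val, pow_succ]; ring
    · rename_i h0
      have h0' : ¬ k % 2 = 0 := Nat.ne_of_beq_eq_false h0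
      refine ih _ _ hk2 (fun l hl h => hc l ?_ h) h
      rw [hl]
      have : k = 2 * (k / 2) + 1 := by omega
      conv_rhs => rw [this]
      simp [val, pow_succ]; ring

theorem initC_sound {P : Prop} {cont : Tr → Bool}
    (hc : ∀ T', Valid phi T' → cont T' = true → P) :
    ∀ (ds : List ℕ) (k : ℕ) (T : Tr), defsList.drop k = ds → Valid phi T →
      initC ds k T cont = true → P
  | [], k, T, _, hT, h => hc T hT h
  | d :: ds, k, T, hd, hT, h => by
    rw [initC] at h
    split at h
    · rename_i h1 h2
      have h1' : d / 4 < k := Nat.le_of_ble_eq_true h1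
      have h2' : k ≤ 2047 := Nat.le_of_ble_eq_true h2
      have hdk : defsList.getD k 0 = d := by
        have h4 : (defsList.drop k)[0]? = some d := by rw [hd]; rfl
        rw [List.getElem?_drop] at h4
        rw [List.getD_eq_getElem?_getD]
        simp at h4
        simp [h4]
      have hds : defsList.drop (k + 1) = ds := by
        rw [← List.tail_drop, hd]; rfl
      refine bitsC_val 11 _ _ (by change d / 4 < _; norm_num; omega) (fun a ha h => ?_) h
      refine bitsC_val 11 _ _ (by norm_num; omega) (fun b hb h => ?_) h
      have hab : act [gen4 (Nat.mod d 4)] (phi a) = phi b := by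
        have ha' : val a = d / 4 := by rw [ha]; simp [val]; rfl
        have hb' : val b = k := by rw [hb]; simp [val]
        rw [phi, phi, ha', hb']
        conv_rhs => rw [phiN]
        rw [hdk, dif_pos h1']
        rfl
      refine setC_sound hT hab (fun T1 hT1 h => ?_) h
      refine setC_sound hT1 (act_inv hab) (fun T2 hT2 h => ?_) h
      exact initC_sound hc ds (k + 1) T2 hds hT2 h
    · cases h

/-! ### The upper bound -/

def enum : Tr → List Lab
  | .L => []
  | .R a _ _ _ e => match a, e with
    | _ :: _, [] => [[]]
    | _, _ => []
  | .N l r => (enum l).map (List.cons false) ++ (enum r).map (List.cons true)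

theorem length_enum (T : Tr) : (enum T).length = cnt T := by
  induction T with
  | L => rfl
  | R a b c d e => cases a <;> cases e <;> rfl
  | N l r hl hr => simp [enum, cnt, hl, hr]

theorem mem_enum : ∀ (T : Tr) (k : Lab), isLive T k = true → k ∈ enum T := by
  intro T
  induction T with
  | L => intro k h; simp [isLive, get_L] at h
  | R a b c d e =>
    intro k h
    cases k with
    | nil => cases a <;> cases e <;> simp_all [isLive, get_L, get_R_nil, get_R_cons, get_N_nil, get_N_false, get_N_true, enum]
    | cons i k => simp [isLive, get_L, get_R_nil, get_R_cons, get_N_nil, get_N_false, get_N_true] at h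
  | N l r hl hr =>
    intro k h
    cases k with
    | nil => simp [isLive, get_L, get_R_nil, get_R_cons, get_N_nil, get_N_false, get_N_true] at h
    | cons i k =>
      cases i
      · have := hl k (by simpa [isLive_N_false, isLive_N_true] using h)
        simp [enum, this]
      · have := hr k (by simpa [isLive_N_false, isLive_N_true] using h)
        simp [enum, this]

theorem closedT_spec (T₀ : Tr) : ∀ T, closedT T₀ T = true → ∀ k, isLive T k = true →
    isLive T₀ (get T k .x) = true ∧ isLive T₀ (get T k .X) = true ∧
    isLive T₀ (get T k .y) = true ∧ isLive T₀ (get T k .t) = true := by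
  intro T
  induction T with
  | L => intro _ k h; simp [isLive, get_L] at h
  | R a b c d e =>
    intro h1 k h
    cases k with
    | nil => cases a <;> cases e <;> simp_all [isLive, get_L, get_R_nil, get_R_cons, get_N_nil, get_N_false, get_N_true, closedT]
    | cons i k => simp [isLive, get_L, get_R_nil, get_R_cons, get_N_nil, get_N_false, get_N_true] at h
  | N l r hl hr =>
    intro h1 k h
    rw [closedT, Bool.and_eq_true] at h1
    cases k with
    | nil => simp [isLive, get_L, get_R_nil, get_R_cons, get_N_nil, get_N_false, get_N_true] at h
    | cons i k =>
      cases i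
      · exact hl h1.1 k (by simpa [isLive_N_false, isLive_N_true] using h)
      · exact hr h1.2 k (by simpa [isLive_N_false, isLive_N_true] using h)

theorem gen_induction {Q : G → Prop} (h1 : Q 1) (hm : ∀ a b, Q a → Q b → Q (a * b))
    (hx : Q x) (hX : Q x⁻¹) (hy : Q y) (ht : Q t) (g : G) : Q g := by
  have hg : g ∈ Subgroup.closure (Set.range (PresentedGroup.of (rels := rels))) := by
    rw [PresentedGroup.closure_range_of]; trivial
  have hQ : ∀ i : Fin 3, Q (PresentedGroup.of i) ∧ Q (PresentedGroup.of (rels := rels) i)⁻¹ := by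
    intro i
    fin_cases i
    · exact ⟨hx, hX⟩
    · exact ⟨hy, by have := hy; rw [← y_inv] at this; exact this⟩
    · exact ⟨ht, by have := ht; rw [← t_inv] at this; exact this⟩
  have : Q g ∧ Q g⁻¹ := by
    induction hg using Subgroup.closure_induction with
    | mem a ha => obtain ⟨i, rfl⟩ := ha; exact hQ i
    | one => simpa using h1
    | mul a b _ _ iha ihb => exact ⟨hm _ _ iha.1 ihb.1, by rw [mul_inv_rev]; exact hm _ _ ihb.2 iha.2⟩
    | inv a _ iha => exact ⟨iha.2, by simpa using iha.1⟩
  exact this.1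

theorem final_sound {T : Tr} {o : Lab} (hT : Valid phi T) (ho : phi o = base)
    (h : finalCheck o T = true) :
    ∃ L : List (G ⧸ M), L.length ≤ 330 ∧ ∀ p, p ∈ L := by
  have h' : get T [] .x = [] ∧ isLive T o = true ∧ Nat.ble (cnt T) 330 = true ∧
      closedT T T = true := by
    cases T with
    | L => simp [finalCheck] at h
    | R a b c d e => simp [finalCheck] at h
    | N l r => exact ⟨rfl, by simpa only [finalCheck, Bool.and_eq_true] using h⟩
  obtain ⟨h0, h1, h2, h3⟩ := h'
  have h2 : cnt T ≤ 330 := Nat.le_of_ble_eq_true h2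
  refine ⟨(enum T).map phi, by simpa [length_enum] using h2, ?_⟩
  have key : ∀ g : G, ∀ k, isLive T k = true → ∃ k', isLive T k' = true ∧ phi k' = g • phi k := by
    have step : ∀ (k : Lab) (g : Ge), isLive T (get T k g) = true → isLive T k = true →
        ∃ k', isLive T k' = true ∧ phi k' = (lev x y t g)⁻¹ • phi k := by
      intro k g hl _
      refine ⟨get T k g, hl, ?_⟩
      have hne : get T k g ≠ [] := by
        intro hne
        rw [hne] at hl
        simp [isLive, h0] at hl
      rw [← hT k g hne]; simp [act, wev]
    intro g
    induction g using gen_induction with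
    | h1 => intro k hk; exact ⟨k, hk, by simp⟩
    | hm a b iha ihb =>
      intro k hk
      obtain ⟨k1, hk1, e1⟩ := ihb k hk
      obtain ⟨k2, hk2, e2⟩ := iha k1 hk1
      exact ⟨k2, hk2, by rw [e2, e1, mul_smul]⟩
    | hx =>
      intro k hk
      simpa [lev] using step k .X (closedT_spec T T h3 k hk).2.1 hk
    | hX =>
      intro k hk
      simpa [lev] using step k .x (closedT_spec T T h3 k hk).1 hk
    | hy =>
      intro k hk
      simpa [lev, y_inv] using step k .y (closedT_spec T T h3 k hk).2.2.1 hk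
    | ht =>
      intro k hk
      simpa [lev, t_inv] using step k .t (closedT_spec T T h3 k hk).2.2.2 hk
  intro p
  obtain ⟨g, rfl⟩ := QuotientGroup.mk_surjective p
  obtain ⟨k', hk', e⟩ := key g o h1
  refine List.mem_map.2 ⟨k', mem_enum T k' hk', ?_⟩
  rw [e, ho, base, MulAction.Quotient.smul_coe, smul_eq_mul, mul_one]

theorem phi_zero {o : Lab} (ho : val o = 0) : phi o = base := by
  rw [phi, ho, phiN, dif_neg (by omega)]

theorem act_base (w : List Ge) (h : wev x y t w ∈ M) : act w base = base := by
  rw [act, base, MulAction.Quotient.smul_coe, smul_eq_mul, mul_one, QuotientGroup.eq]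
  simpa using h

theorem upper : ∃ L : List (G ⧸ M), L.length ≤ 330 ∧ ∀ p, p ∈ L := by
  have h := check_true
  unfold check at h
  refine initC_sound (fun T hT h => ?_) _ 1 _ rfl (fun k g h => absurd (get_L k g) h) h
  refine bitsC_val 11 0 [] (by norm_num) (fun o ho h => ?_) h
  have ho : phi o = base := phi_zero (by simpa [val] using ho)
  refine edgeC_sound hT ?_ (fun T hT h => ?_) h
  · rw [ho]; exact act_base _ (by simpa [wev, lev] using x_mem)
  refine edgeC_sound hT ?_ (fun T hT h => ?_) h
  · rw [ho]; exact act_base _ (by simpa [wev, lev] using y_mem)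
  refine traceC_sound hT _ _ (fun a ha h => ?_) h
  refine edgeC_sound hT ?_ (fun T hT h => ?_) h
  · rw [← ha, ← act_append, ho]
    exact act_base _ (by simpa [wev, lev, mul_assoc] using sub_mem)
  exact runC_sound (fun T hT h => final_sound hT ho h) _ T hT h

/-! ### The lower bound: an action on 330 points -/

def tabx : ℕ :=
  715156469742029070594239867256546485109987583741660847752894043020377833484731361481871637082374432823063491173174781405743431695131106705785335752316256896464194019713513196235494815232780339336357332989440850372603270383434432392930404461836317025299851102853989360881472388740409949682084107357455024474669955424832714561237307277337213552954871620308019758658983238458314879902571451058415907533323700028229010434850698887087551906109063153628847001048989124301739026791576709015496519399054629386814757991027917909140240019361468905115664167105437825068251322264453696303536396506713546421790383470504149619128573573664826432634154787770860037194720654897335859140280160524656110096275761403054193886830517746636665156740245369241635405784524384987565202524544832910044602291708925162798576263562274589994664731059354210544219998825422496015550032698677824428096195060153533001890783299072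

def tabX : ℕ :=
  670357289472841049845646724849170797458624052378680466690255374992575600531461786754855953181252438203454960389874646613101974559564455223571643539338265816340664097661008186362146254302027643522286909352160677413615807661347021789732963467031052858518737033701024635760587583233171306545140133665547721014902636180470848523607020317721037867473694639622279020783709040407754639070891763301238493076450027585910704534316421052555523463964390966809229139164397243285074010551580204387943478847677607194249547673290750042408571031337760278591318832993444327551309985874716847623515261083531018772082364545753378364002427316069574996752222369265090475634022806010127931459862396066407650498613475914382448025732074963394083081404703988355836621731675778653330586455056060910099453753128941143692221231890250121322386536852560665098762033960762105046136608902313796162683270047244105462876174550016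

def taby : ℕ :=
  715147822154505673889205962392402959726334880768390449848372325493380568065774099071196692685847026904561741852431519893283639486822976620163805775459287787154047492874549471143152613249551689203909481594896059582069585241986446437922735350478582200474160937809988754457883038392664116927546508241984536280649253039916396286902765651521938053375201844850618395397799838229132870713609334777669618459469491474387069846532805948805564774761256483560006211314748266281889354545167672444574264473127862918564493707404023963668034596002710051386007419610609265592231177813847340032695126496887751444363317791004679251472478680623156447571097151467386276577873508419274903859803070812478950811479696743713976920547075623493999366475230726316938958378426513128308300821900928583652126012970617805974741418973236941600244294168141048280114865957809661461598221176215772093792342464562324847287447323136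

def tabt : ℕ :=
  708434247475003537742963217699289385263467839522587389857126983643934991531534579299321712162262022423616698662698312782890621064802593225924286100329348961393673204955652332272877713883428585093746735908392970031279762777462720770533170431346506939983191122504461227960274085745918000168694839103658883208395403411510839801328421033614088468329494112905323579120831512222196422839431442432786148922164807708694909134074702047958828995069416681313652916676002511660335489905450727404690033796775397016755019643584401942260611464222536666043715605110773706727761050412052076345309357312637349411890784543766847941380019806903188384071726363512014301182530481579942976235998925732006945933113733460746194165838640186295343310532055905065484314517153888166546985093363881788253814762371609539346240522179846366340479869933059886657433402256581780767617750838619649920776477469689809402485219524609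

def lk (tab a : ℕ) : ℕ := Nat.mod (Nat.shiftRight tab (Nat.mul 9 a)) 512

/-- The action of the letters on the points `0, …, 329`. -/
def pl : Ge → ℕ → ℕ
  | .x => lk tabx | .X => lk tabX | .y => lk taby | .t => lk tabt | .e => id

def plw : List Ge → ℕ → ℕ
  | [], a => a
  | g :: w, a => pl g (plw w a)

theorem pl_lt : ∀ a < 330, pl .x a < 330 ∧ pl .X a < 330 ∧ pl .y a < 330 ∧ pl .t a < 330 := by
  decide +kernel

theorem pl_inv : ∀ a < 330, pl .X (pl .x a) = a ∧ pl .x (pl .X a) = a ∧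
    pl .y (pl .y a) = a ∧ pl .t (pl .t a) = a := by
  decide +kernel

theorem pl_rel : ∀ a < 330, ∀ w ∈ relWords, plw w a = a := by
  decide +kernel

theorem pl_sub : pl .x 0 = 0 ∧ pl .y 0 = 0 ∧
    plw [.X, .t, .x, .y, .X, .X, .X, .X, .X, .t, .x, .x, .x, .x, .x, .y] 0 = 0 := by
  decide +kernel

theorem pl_trans : ∀ a < 330, a = 0 ∨ pl .x a < a ∨ pl .X a < a ∨ pl .y a < a ∨ pl .t a < a := by
  decide +kernel

def sx : Equiv.Perm (Fin 330) where
  toFun a := ⟨pl .x a, (pl_lt a a.2).1⟩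
  invFun a := ⟨pl .X a, (pl_lt a a.2).2.1⟩
  left_inv a := Fin.ext (pl_inv a a.2).1
  right_inv a := Fin.ext (pl_inv a a.2).2.1

def sy : Equiv.Perm (Fin 330) where
  toFun a := ⟨pl .y a, (pl_lt a a.2).2.2.1⟩
  invFun a := ⟨pl .y a, (pl_lt a a.2).2.2.1⟩
  left_inv a := Fin.ext (pl_inv a a.2).2.2.1
  right_inv a := Fin.ext (pl_inv a a.2).2.2.1

def st : Equiv.Perm (Fin 330) where
  toFun a := ⟨pl .t a, (pl_lt a a.2).2.2.2⟩
  invFun a := ⟨pl .t a, (pl_lt a a.2).2.2.2⟩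
  left_inv a := Fin.ext (pl_inv a a.2).2.2.2
  right_inv a := Fin.ext (pl_inv a a.2).2.2.2

theorem sy_inv : sy⁻¹ = sy := rfl
theorem st_inv : st⁻¹ = st := rfl

theorem lev_perm (g : Ge) (a : Fin 330) : (lev sx sy st g a : ℕ) = pl g a := by
  cases g <;> rfl

theorem wev_perm (w : List Ge) (a : Fin 330) : (wev sx sy st w a : ℕ) = plw w a := by
  induction w with
  | nil => rfl
  | cons g w ih =>
    change (lev sx sy st g (wev sx sy st w a) : ℕ) = pl g (plw w a)
    rw [lev_perm, ih]

theorem lift_rels_gen {H : Type*} [Group H] (a b c : H) (hb : b ^ 2 = 1) (hc : c ^ 2 = 1)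
    (h : ∀ g ∈ relExprs a b c, g = 1) : ∀ r ∈ rels, FreeGroup.lift ![a, b, c] r = 1 := by
  have hx : FreeGroup.lift ![a, b, c] fx = a := by simp [fx]
  have hy : FreeGroup.lift ![a, b, c] fy = b := by simp [fy]
  have ht : FreeGroup.lift ![a, b, c] ft = c := by simp [ft]
  simp only [relExprs, List.forall_mem_cons] at h
  obtain ⟨h1, h2, h3, h4, h5, h6, h7, h8, -⟩ := h
  intro r hr
  simp only [rels, Set.mem_insert_iff, Set.mem_singleton_iff] at hr
  rcases hr with rfl | rfl | rfl | rfl | rfl | rfl | rfl | rfl | rfl | rfl <;>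
    simp only [fcomm, fconj, map_mul, map_pow, map_inv, hx, hy, ht] <;> assumption

theorem perm_rels : ∀ g ∈ relExprs sx sy st, g = 1 := by
  rw [← relExprs_eq sx sy st sy_inv st_inv]
  intro g hg
  obtain ⟨w, hw, rfl⟩ := List.mem_map.1 hg
  ext a
  rw [wev_perm]
  exact pl_rel a a.2 w hw

theorem lift_rels : ∀ r ∈ rels, FreeGroup.lift ![sx, sy, st] r = 1 :=
  lift_rels_gen sx sy st (by rw [pow_two, ← inv_eq_iff_mul_eq_one, sy_inv])
    (by rw [pow_two, ← inv_eq_iff_mul_eq_one, st_inv]) perm_rels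

noncomputable def psi : G →* Equiv.Perm (Fin 330) := PresentedGroup.toGroup lift_rels

theorem psi_x : psi x = sx := PresentedGroup.toGroup.of lift_rels
theorem psi_y : psi y = sy := PresentedGroup.toGroup.of lift_rels
theorem psi_t : psi t = st := PresentedGroup.toGroup.of lift_rels

theorem psi_M (m : G) (hm : m ∈ M) : psi m 0 = 0 := by
  have h : M ≤ (MulAction.stabilizer (Equiv.Perm (Fin 330)) (0 : Fin 330)).comap psi := by
    rw [M, Subgroup.closure_le]
    rintro g (rfl | rfl | rfl)
    · change psi x 0 = 0
      rw [psi_x]; exact Fin.ext pl_sub.1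
    · change psi y 0 = 0
      rw [psi_y]; exact Fin.ext pl_sub.2.1
    · change psi (s 1) 0 = 0
      have e : psi (s 1) =
          wev sx sy st [.X, .t, .x, .y, .X, .X, .X, .X, .X, .t, .x, .x, .x, .x, .x, .y] := by
        rw [s_one]
        simp only [map_mul, map_pow, map_inv, psi_x, psi_y, psi_t, wev, lev, pow_succ, pow_zero,
          mul_inv_rev, mul_assoc, one_mul, mul_one]
      rw [e]
      apply Fin.ext
      rw [wev_perm]
      exact pl_sub.2.2
  exact h hm

theorem psi_surj : ∀ a : Fin 330, ∃ g : G, psi g 0 = a := by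
  have key : ∀ n, ∀ h : n < 330, ∃ g : G, psi g 0 = ⟨n, h⟩ := by
    intro n
    induction n using Nat.strong_induction_on with
    | _ n ih =>
      intro h
      have step : ∀ (z : G) (g : Ge), psi z = lev sx sy st g → pl g n < n →
          ∃ g : G, psi g 0 = ⟨n, h⟩ := by
        intro z g hz hlt
        obtain ⟨u, hu⟩ := ih _ hlt (hlt.trans h)
        refine ⟨z⁻¹ * u, ?_⟩
        rw [map_mul, map_inv, Equiv.Perm.mul_apply, hu, Equiv.Perm.inv_eq_iff_eq, hz]
        apply Fin.ext
        rw [lev_perm]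
      rcases pl_trans n h with rfl | h1 | h1 | h1 | h1
      · exact ⟨1, by simp⟩
      · exact step x .x psi_x h1
      · exact step x⁻¹ .X (by rw [map_inv, psi_x]; rfl) h1
      · exact step y .y psi_y h1
      · exact step t .t psi_t h1
  intro a
  exact key a a.2

noncomputable def cosetMap : G ⧸ M → Fin 330 :=
  Quotient.lift (fun g : G => psi g 0) (by
    intro a b hab
    have hab' : a⁻¹ * b ∈ M := QuotientGroup.leftRel_apply.1 hab
    have := psi_M _ hab'
    rw [map_mul, map_inv, Equiv.Perm.mul_apply, Equiv.Perm.inv_eq_iff_eq] at this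
    exact this.symm)

theorem cosetMap_surj : Function.Surjective cosetMap := by
  intro a
  obtain ⟨g, hg⟩ := psi_surj a
  exact ⟨(g : G ⧸ M), hg⟩

theorem M_index_aux : M.index = 330 := by
  classical
  obtain ⟨L, hL, hmem⟩ := upper
  have hfin : Finite (G ⧸ M) :=
    Set.finite_univ_iff.1 ((L.toFinset.finite_toSet).subset fun p _ => by simpa using hmem p)
  have := Fintype.ofFinite (G ⧸ M)
  rw [Subgroup.index, Nat.card_eq_fintype_card]
  apply le_antisymm
  · calc Fintype.card (G ⧸ M) = (Finset.univ : Finset (G ⧸ M)).card := rfl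
      _ ≤ L.toFinset.card := Finset.card_le_card fun p _ => by simpa using hmem p
      _ ≤ L.length := L.toFinset_card_le
      _ ≤ 330 := hL
  · simpa using Fintype.card_le_of_surjective _ cosetMap_surj

/-- `𝓜` has index `330` in `G`. -/
theorem M_index : M.index = 330 := by
  exact M_index_aux

end M22
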